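/- arXiv:2006.04997 — 3 statements merged into one kernel-verified Lean document; each statement's English description precedes it below -/
import Mathlib

section
/- Assume Γ is Q-polynomial with respect to E. Then for all vertices x, y ∈ X with i = ∂(x,y): E x̂ ⋆ E ŷ = [ (θ*_{i-1} − θ*_i) E x⁻_y + (θ*_{i+1} − θ*_i) E x⁺_y + (θ₁ − θ₂) θ*_i E x̂ + (θ₂ − θ₀) E ŷ ] / ( |X| (θ₁ − θ₂) ). -/
open Matrix Finset
open scoped Classical

/-- A distance-regular graph `Γ` with vertex set `X`, path-length distance
`G.dist`, diameter `d ≥ 2`, and intersection numbers `p h i j`. -/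
structure DRG where
  X : Type
  [fin : Fintype X]
  [deceq : DecidableEq X]
  G : SimpleGraph X
  conn : G.Connected
  d : ℕ
  d_ge_two : 2 ≤ d
  dist_le : ∀ x y : X, G.dist x y ≤ d
  dist_attained : ∃ x y : X, G.dist x y = d
  p : ℕ → ℕ → ℕ → ℕ
  dist_regular : ∀ (h i j : ℕ) (x y : X), G.dist x y = h →
    (Finset.univ.filter fun z => G.dist x z = i ∧ G.dist y z = j).card = p h i j

attribute [instance] DRG.fin DRG.deceq

namespace DRG

variable (Γ : DRG)

/-- `Γ_i(x) = {z : ∂(x,z) = i}`. -/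
noncomputable def sphere (x : Γ.X) (i : ℕ) : Finset Γ.X :=
  Finset.univ.filter fun z => Γ.G.dist x z = i

/-- The number of vertices `|X|`, as a real number. -/
noncomputable def n : ℝ := (Fintype.card Γ.X : ℝ)

/-- The `i`-th distance matrix `A_i`. -/
noncomputable def Ai (i : ℕ) : Matrix Γ.X Γ.X ℝ :=
  Matrix.of fun x y => if Γ.G.dist x y = i then (1 : ℝ) else 0

/-- The adjacency matrix `A = A_1`. -/
noncomputable def A : Matrix Γ.X Γ.X ℝ := Γ.Ai 1

/-- The all-ones matrix `J`. -/
def Jmat : Matrix Γ.X Γ.X ℝ := Matrix.of fun _ _ => (1 : ℝ)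

/-- `c_i = p^i_{1,i-1}` (so `c_0 = 0`). -/
noncomputable def c (i : ℕ) : ℝ := (Γ.p i 1 (i - 1) : ℝ)

/-- `a_i = p^i_{1,i}`. -/
noncomputable def a (i : ℕ) : ℝ := (Γ.p i 1 i : ℝ)

/-- `b_i = p^i_{1,i+1}` (so `b_d = 0`). -/
noncomputable def b (i : ℕ) : ℝ := (Γ.p i 1 (i + 1) : ℝ)

/-- The standard basis vector `x̂`. -/
noncomputable def hatv (x : Γ.X) : Γ.X → ℝ := Pi.single x 1

/-- `x⁺_y = Σ_{z ∈ Γ(x) ∩ Γ_{i+1}(y)} ẑ` where `i = ∂(x,y)`. -/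
noncomputable def plusv (x y : Γ.X) : Γ.X → ℝ :=
  ∑ z ∈ Γ.sphere x 1 ∩ Γ.sphere y (Γ.G.dist x y + 1), Γ.hatv z

/-- `x⁰_y = Σ_{z ∈ Γ(x) ∩ Γ_i(y)} ẑ` where `i = ∂(x,y)`. -/
noncomputable def zerov (x y : Γ.X) : Γ.X → ℝ :=
  ∑ z ∈ Γ.sphere x 1 ∩ Γ.sphere y (Γ.G.dist x y), Γ.hatv z

/-- `x⁻_y = Σ_{z ∈ Γ(x) ∩ Γ_{i-1}(y)} ẑ` where `i = ∂(x,y)`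
(for `i = 0` this is the zero vector, matching `Γ_{-1}(y) = ∅`). -/
noncomputable def minusv (x y : Γ.X) : Γ.X → ℝ :=
  ∑ z ∈ Γ.sphere x 1 ∩ Γ.sphere y (Γ.G.dist x y - 1), Γ.hatv z

/-- The Norton product `u ⋆ v = E (u ∘ v)`, where `∘` is the entrywise
(Hadamard) product of vectors. -/
noncomputable def norton (E : Matrix Γ.X Γ.X ℝ) (u v : Γ.X → ℝ) : Γ.X → ℝ :=
  E *ᵥ (u * v)

/-- `E 0, …, E d` is the sequence of primitive idempotents of the Bose–Mesner
algebra, with `E 0 = |X|⁻¹ J`, and `θ 0, …, θ d` are the corresponding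
(mutually distinct) eigenvalues, so that `A = Σ_i θ i • E i`. -/
def IsPrimIdemSeq (E : ℕ → Matrix Γ.X Γ.X ℝ) (θ : ℕ → ℝ) : Prop :=
  E 0 = (Γ.n)⁻¹ • Γ.Jmat ∧
  ∑ i ∈ Finset.range (Γ.d + 1), E i = 1 ∧
  (∀ i j : ℕ, i ≤ Γ.d → j ≤ Γ.d → E i * E j = if i = j then E i else 0) ∧
  Γ.A = ∑ i ∈ Finset.range (Γ.d + 1), θ i • E i ∧
  (∀ i j : ℕ, i ≤ Γ.d → j ≤ Γ.d → θ i = θ j → i = j)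

/-- `q h i j` are the Krein parameters:
`E i ∘ E j = |X|⁻¹ Σ_h q h i j • E h`, with `∘` the entrywise product. -/
def IsKrein (E : ℕ → Matrix Γ.X Γ.X ℝ) (q : ℕ → ℕ → ℕ → ℝ) : Prop :=
  ∀ i j : ℕ, i ≤ Γ.d → j ≤ Γ.d →
    Matrix.hadamard (E i) (E j) =
      (Γ.n)⁻¹ • ∑ h ∈ Finset.range (Γ.d + 1), q h i j • E h

/-- The ordering `E 1, …, E d` is `Q`-polynomial: for `0 ≤ h,i,j ≤ d`,
`q h i j = 0` if one of `h,i,j` is greater than the sum of the other two, and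
`q h i j ≠ 0` if one of `h,i,j` equals the sum of the other two. -/
def IsQPolynomial (q : ℕ → ℕ → ℕ → ℝ) : Prop :=
  ∀ h i j : ℕ, h ≤ Γ.d → i ≤ Γ.d → j ≤ Γ.d →
    ((i + j < h ∨ h + j < i ∨ h + i < j) → q h i j = 0) ∧
    ((h = i + j ∨ i = h + j ∨ j = h + i) → q h i j ≠ 0)

/-- `ts 0, …, ts d` are the (mutually distinct) dual eigenvalues associated
with `E`, i.e. `E = |X|⁻¹ Σ_i ts i • A i`.  The values `ts (-1)` and
`ts (d+1)` are arbitrary reals (indeterminates). -/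
def IsDualEigs (E : Matrix Γ.X Γ.X ℝ) (ts : ℤ → ℝ) : Prop :=
  E = (Γ.n)⁻¹ • ∑ i ∈ Finset.range (Γ.d + 1), ts i • Γ.Ai i

/-- The dual eigenvalues `ts 0, …, ts d` are mutually distinct. -/
def DualDistinct (ts : ℤ → ℝ) : Prop :=
  ∀ i j : ℕ, i ≤ Γ.d → j ≤ Γ.d → ts i = ts j → i = j

/-- `C(x,y) = E x⁻_y − c_i ((θ*_1 − θ*_{i-1})/(θ*_0 − θ*_i)) E x̂`,
where `i = ∂(x,y)`. -/
noncomputable def Cvec (E : Matrix Γ.X Γ.X ℝ) (ts : ℤ → ℝ) (x y : Γ.X) :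
    Γ.X → ℝ :=
  E *ᵥ Γ.minusv x y -
    (Γ.c (Γ.G.dist x y) *
      ((ts 1 - ts ((Γ.G.dist x y : ℤ) - 1)) / (ts 0 - ts (Γ.G.dist x y)))) •
      (E *ᵥ Γ.hatv x)

/-- `B(x,y) = E x⁺_y − b_i ((θ*_1 − θ*_{i+1})/(θ*_0 − θ*_i)) E x̂`,
where `i = ∂(x,y)`. -/
noncomputable def Bvec (E : Matrix Γ.X Γ.X ℝ) (ts : ℤ → ℝ) (x y : Γ.X) :
    Γ.X → ℝ :=
  E *ᵥ Γ.plusv x y -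
    (Γ.b (Γ.G.dist x y) *
      ((ts 1 - ts ((Γ.G.dist x y : ℤ) + 1)) / (ts 0 - ts (Γ.G.dist x y)))) •
      (E *ᵥ Γ.hatv x)

end DRG

namespace DRG

variable {Γ : DRG}

theorem n_ne_zero (Γ : DRG) : Γ.n ≠ 0 := by
  obtain ⟨x, -⟩ := Γ.dist_attained
  have : Nonempty Γ.X := ⟨x⟩
  simp [n, Fintype.card_ne_zero]

theorem A_transpose (Γ : DRG) : Γ.Aᵀ = Γ.A := by
  ext u v
  simp [A, Ai, SimpleGraph.adj_comm]

namespace IsPrimIdemSeq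

variable {E : ℕ → Matrix Γ.X Γ.X ℝ} {θ : ℕ → ℝ}

theorem mul_A (hE : Γ.IsPrimIdemSeq E θ) {i : ℕ} (hi : i ≤ Γ.d) :
    E i * Γ.A = θ i • E i := by
  rw [hE.2.2.2.1, Matrix.mul_sum, Finset.sum_eq_single_of_mem i (by simp; omega)]
  · rw [Matrix.mul_smul, hE.2.2.1 i i hi hi, if_pos rfl]
  · intro j hj hji
    rw [Matrix.mul_smul, hE.2.2.1 i j hi (by simp at hj; omega), if_neg hji.symm, smul_zero]

theorem transpose_eq (hE : Γ.IsPrimIdemSeq E θ) {i : ℕ} (hi : i ≤ Γ.d) : (E i)ᵀ = E i := by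
  have A_mul (j : ℕ) (hj : j ≤ Γ.d) : Γ.A * (E j)ᵀ = θ j • (E j)ᵀ := by
    rw [← Matrix.transpose_smul, ← hE.mul_A hj, Matrix.transpose_mul, A_transpose]
  have orthogonal (j : ℕ) (hj : j ≤ Γ.d) (hji : j ≠ i) : E i * (E j)ᵀ = 0 := by
    have h : θ i • (E i * (E j)ᵀ) = θ j • (E i * (E j)ᵀ) := by
      rw [← Matrix.smul_mul, ← hE.mul_A hi, Matrix.mul_assoc, A_mul j hj, Matrix.mul_smul]
    rw [← sub_eq_zero, ← sub_smul, smul_eq_zero, sub_eq_zero] at h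
    exact h.resolve_left fun h => hji (hE.2.2.2.2 i j hi hj h).symm
  have h : E i = E i * (E i)ᵀ := by
    have sum_transpose : ∑ j ∈ Finset.range (Γ.d + 1), (E j)ᵀ = 1 := by
      rw [← Matrix.transpose_sum, hE.2.1, Matrix.transpose_one]
    calc E i = E i * ∑ j ∈ Finset.range (Γ.d + 1), (E j)ᵀ := by
          rw [sum_transpose, Matrix.mul_one]
      _ = E i * (E i)ᵀ := by
          rw [Matrix.mul_sum, Finset.sum_eq_single_of_mem i (by simp; omega)]
          intro j hj hji
          exact orthogonal j (by simp at hj; omega) hji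
  rw [h, Matrix.transpose_mul, Matrix.transpose_transpose]

/-- A triple product relation: the block `E_i A*_i E_j` of a dual matrix vanishes together with
the Krein parameter `q^i_{i,j}`. -/
theorem mul_diagonal_mul_eq_zero (hE : Γ.IsPrimIdemSeq E θ) {q : ℕ → ℕ → ℕ → ℝ}
    (hq : Γ.IsKrein E q) {i j : ℕ} (hi : i ≤ Γ.d) (hj : j ≤ Γ.d) (hij : q i i j = 0)
    (v : Γ.X → ℝ) : E i * diagonal (E i *ᵥ v) * E j = 0 := by
  set z := E i *ᵥ v with hz
  have mulVec_z (h : ℕ) (hh : h ≤ Γ.d) (hne : h ≠ i) : E h *ᵥ z = 0 := by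
    rw [hz, Matrix.mulVec_mulVec, hE.2.2.1 h i hh hi, if_neg hne, Matrix.zero_mulVec]
  have quadratic_form : z ⬝ᵥ (Matrix.hadamard (E i) (E j) *ᵥ z) = 0 := by
    have h : Matrix.hadamard (E i) (E j) *ᵥ z = 0 := by
      rw [hq i j hi hj, Matrix.smul_mulVec, Matrix.sum_mulVec, Finset.sum_eq_zero, smul_zero]
      intro h hh
      rw [Matrix.smul_mulVec]
      by_cases hne : h = i
      · rw [hne, hij, zero_smul]
      · rw [mulVec_z h (by simp at hh; omega) hne, smul_zero]
    rw [h, dotProduct_zero]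
  rw [Matrix.dotProduct_mulVec, Matrix.dotProduct_vecMul_hadamard, Matrix.transpose_mul,
    Matrix.diagonal_transpose, hE.transpose_eq hj] at quadratic_form
  rw [← Matrix.trace_mul_conjTranspose_self_eq_zero_iff,
    Matrix.conjTranspose_eq_transpose_of_trivial, Matrix.transpose_mul, Matrix.transpose_mul,
    Matrix.diagonal_transpose, hE.transpose_eq hi, hE.transpose_eq hj, ← quadratic_form]
  have idem_i : E i * E i = E i := by rw [hE.2.2.1 i i hi hi, if_pos rfl]
  have idem_j : E j * E j = E j := by rw [hE.2.2.1 j j hj hj, if_pos rfl]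
  calc trace (E i * diagonal z * E j * (E j * (diagonal z * E i)))
      = trace (E i * (diagonal z * (E j * E j) * diagonal z * E i)) := by
        simp only [Matrix.mul_assoc]
    _ = trace (diagonal z * E j * diagonal z * (E i * E i)) := by
        rw [Matrix.trace_mul_comm, idem_j]
        simp only [Matrix.mul_assoc]
    _ = trace (diagonal z * E j * (diagonal z * E i)) := by
        rw [idem_i]
        simp only [Matrix.mul_assoc]
    _ = trace (diagonal z * E i * (diagonal z * E j)) := Matrix.trace_mul_comm _ _

/-- A weighted sum of the blocks `E_1 A* E_j` only has the terms `j = 0, 1, 2`. -/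
theorem mul_diagonal_mul_sum (hE : Γ.IsPrimIdemSeq E θ) {q : ℕ → ℕ → ℕ → ℝ}
    (hq : Γ.IsKrein E q) (hQ : Γ.IsQPolynomial q) (v : Γ.X → ℝ) (w : ℕ → ℝ) :
    E 1 * diagonal (E 1 *ᵥ v) * ∑ j ∈ Finset.range (Γ.d + 1), w j • E j =
      ∑ j ∈ Finset.range 3, w j • (E 1 * diagonal (E 1 *ᵥ v) * E j) := by
  have hd := Γ.d_ge_two
  simp only [Matrix.mul_sum, Matrix.mul_smul]
  refine (Finset.sum_subset (Finset.range_mono (by omega)) ?_).symm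
  intro j hj hj3
  simp only [Finset.mem_range] at hj hj3
  rw [hE.mul_diagonal_mul_eq_zero hq (by omega) (by omega)
    ((hQ 1 1 j (by omega) (by omega) (by omega)).1 (by omega)), smul_zero]

end IsPrimIdemSeq

theorem IsDualEigs.apply {F : Matrix Γ.X Γ.X ℝ} {ts : ℤ → ℝ} (h : Γ.IsDualEigs F ts)
    (u v : Γ.X) : F u v = Γ.n⁻¹ * ts (Γ.G.dist u v) := by
  have hd := Γ.dist_le u v
  rw [h]
  simp only [Matrix.smul_apply, Matrix.sum_apply, Ai, Matrix.of_apply, smul_eq_mul]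
  rw [Finset.sum_eq_single_of_mem (Γ.G.dist u v) (by simp; omega)]
  · simp
  · intro j _ hj
    simp [hj.symm]

theorem mulVec_hatv (F : Matrix Γ.X Γ.X ℝ) (x u : Γ.X) : (F *ᵥ Γ.hatv x) u = F u x := by
  simp [hatv]

theorem sum_hatv_apply (s : Finset Γ.X) (u : Γ.X) :
    (∑ z ∈ s, Γ.hatv z) u = if u ∈ s then 1 else 0 := by
  simp [hatv, Finset.sum_apply, Pi.single_apply]

theorem minusv_apply (x y u : Γ.X) : Γ.minusv x y u =
    if Γ.G.dist x u = 1 ∧ Γ.G.dist y u = Γ.G.dist x y - 1 then 1 else 0 := by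
  rw [minusv, sum_hatv_apply]
  simp [sphere]

theorem zerov_apply (x y u : Γ.X) : Γ.zerov x y u =
    if Γ.G.dist x u = 1 ∧ Γ.G.dist y u = Γ.G.dist x y then 1 else 0 := by
  rw [zerov, sum_hatv_apply]
  simp [sphere]

theorem plusv_apply (x y u : Γ.X) : Γ.plusv x y u =
    if Γ.G.dist x u = 1 ∧ Γ.G.dist y u = Γ.G.dist x y + 1 then 1 else 0 := by
  rw [plusv, sum_hatv_apply]
  simp [sphere]

theorem A_mulVec_hatv (x y : Γ.X) :
    Γ.A *ᵥ Γ.hatv x = Γ.minusv x y + Γ.zerov x y + Γ.plusv x y := by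
  ext u
  have h₁ := Γ.conn.dist_triangle (u := y) (v := x) (w := u)
  have h₂ := Γ.conn.dist_triangle (u := y) (v := u) (w := x)
  have h₃ := Γ.G.dist_comm (u := y) (v := x)
  have h₄ := Γ.G.dist_comm (u := u) (v := x)
  rw [mulVec_hatv, Pi.add_apply, Pi.add_apply, minusv_apply, zerov_apply, plusv_apply, A, Ai,
    Matrix.of_apply]
  by_cases hu : Γ.G.dist x u = 1
  · have pos (h : Γ.G.dist x y = 0) : Γ.G.dist y u = 1 := by
      rw [← (Γ.conn.dist_eq_zero_iff.1 h), hu]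
    simp only [h₄, hu, true_and, if_true]
    split_ifs <;> first | omega | norm_num
  · simp [h₄, hu]

/-- The dual adjacency matrix acts on a vector supported on a sphere about `y` as a scalar. -/
theorem IsDualEigs.mul_eq_smul {F : Matrix Γ.X Γ.X ℝ} {ts : ℤ → ℝ} (h : Γ.IsDualEigs F ts)
    {y : Γ.X} {v : Γ.X → ℝ} {i : ℤ} (hv : ∀ u, v u ≠ 0 → (Γ.G.dist y u : ℤ) = i) :
    (F *ᵥ Γ.hatv y) * v = (Γ.n⁻¹ * ts i) • v := by
  ext u
  rw [Pi.mul_apply, mulVec_hatv, h.apply, Pi.smul_apply, smul_eq_mul]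
  by_cases hu : v u = 0
  · simp [hu]
  · rw [Γ.G.dist_comm, hv u hu]

end DRG

/-- Theorem 3.7, first main result: the Norton product formula. -/
theorem DRG.norton_product_formula (Γ : DRG) (E : ℕ → Matrix Γ.X Γ.X ℝ) (θ : ℕ → ℝ)
    (hE : Γ.IsPrimIdemSeq E θ)
    (q : ℕ → ℕ → ℕ → ℝ) (hq : Γ.IsKrein E q) (hQ : Γ.IsQPolynomial q)
    (ts : ℤ → ℝ) (hts : Γ.IsDualEigs (E 1) ts) (hts' : Γ.DualDistinct ts) (x y : Γ.X) :
    Γ.norton (E 1) (E 1 *ᵥ Γ.hatv x) (E 1 *ᵥ Γ.hatv y) =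
      (Γ.n * (θ 1 - θ 2))⁻¹ •
        ((ts ((Γ.G.dist x y : ℤ) - 1) - ts (Γ.G.dist x y)) •
            (E 1 *ᵥ Γ.minusv x y) +
          (ts ((Γ.G.dist x y : ℤ) + 1) - ts (Γ.G.dist x y)) •
            (E 1 *ᵥ Γ.plusv x y) +
          ((θ 1 - θ 2) * ts (Γ.G.dist x y)) • (E 1 *ᵥ Γ.hatv x) +
          (θ 2 - θ 0) • (E 1 *ᵥ Γ.hatv y)) := by
  have hd := Γ.d_ge_two
  have hn := Γ.n_ne_zero
  have hθ : θ 1 - θ 2 ≠ 0 := fun h => by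
    simpa using hE.2.2.2.2 1 2 (by omega) hd (sub_eq_zero.1 h)
  set i : ℤ := (Γ.G.dist x y : ℤ) with hi
  have hat_eq : (E 1 *ᵥ Γ.hatv y) * Γ.hatv x = (Γ.n⁻¹ * ts i) • Γ.hatv x := by
    refine hts.mul_eq_smul fun u hu => ?_
    obtain rfl : u = x := by simpa [hatv, Pi.single_apply] using hu
    rw [hi, Γ.G.dist_comm]
  have minus_eq :
      (E 1 *ᵥ Γ.hatv y) * Γ.minusv x y = (Γ.n⁻¹ * ts (i - 1)) • Γ.minusv x y := by
    refine hts.mul_eq_smul fun u hu => ?_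
    rw [minusv_apply, ne_eq, ite_eq_right_iff, Classical.not_imp] at hu
    obtain ⟨⟨hxu, hyu⟩, -⟩ := hu
    have pos : Γ.G.dist x y ≠ 0 := fun h => by
      rw [Γ.conn.dist_eq_zero_iff.1 h] at hxu hyu
      simp_all
    omega
  have zero_eq : (E 1 *ᵥ Γ.hatv y) * Γ.zerov x y = (Γ.n⁻¹ * ts i) • Γ.zerov x y := by
    refine hts.mul_eq_smul fun u hu => ?_
    rw [zerov_apply, ne_eq, ite_eq_right_iff, Classical.not_imp] at hu
    omega
  have plus_eq :
      (E 1 *ᵥ Γ.hatv y) * Γ.plusv x y = (Γ.n⁻¹ * ts (i + 1)) • Γ.plusv x y := by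
    refine hts.mul_eq_smul fun u hu => ?_
    rw [plusv_apply, ne_eq, ite_eq_right_iff, Classical.not_imp] at hu
    omega
  have diagonal_mulVec (v : Γ.X → ℝ) :
      diagonal (E 1 *ᵥ Γ.hatv y) *ᵥ v = (E 1 *ᵥ Γ.hatv y) * v := by
    ext u
    rw [Matrix.mulVec_diagonal, Pi.mul_apply]
  have trivial_block :
      E 1 *ᵥ ((E 1 *ᵥ Γ.hatv y) * (E 0 *ᵥ Γ.hatv x)) = Γ.n⁻¹ • (E 1 *ᵥ Γ.hatv y) := by
    have h : (E 1 *ᵥ Γ.hatv y) * (E 0 *ᵥ Γ.hatv x) = Γ.n⁻¹ • (E 1 *ᵥ Γ.hatv y) := by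
      ext u
      simp [mulVec_hatv, hE.1, Jmat, mul_comm]
    rw [h, Matrix.mulVec_smul, Matrix.mulVec_mulVec, hE.2.2.1 1 1 (by omega) (by omega),
      if_pos rfl]
  have eigen_expansion := congrArg (· *ᵥ Γ.hatv x)
    (hE.mul_diagonal_mul_sum hq hQ (Γ.hatv y) θ)
  have unit_expansion := congrArg (· *ᵥ Γ.hatv x)
    (hE.mul_diagonal_mul_sum hq hQ (Γ.hatv y) fun _ => 1)
  have neighbours : θ 1 • (E 1 *ᵥ Γ.hatv x) =
      E 1 *ᵥ Γ.minusv x y + E 1 *ᵥ Γ.zerov x y + E 1 *ᵥ Γ.plusv x y := by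
    rw [← Matrix.mulVec_add, ← Matrix.mulVec_add, ← A_mulVec_hatv, Matrix.mulVec_mulVec,
      hE.mul_A (by omega), Matrix.smul_mulVec]
  rw [← hE.2.2.2.1] at eigen_expansion
  simp only [one_smul, hE.2.1, Finset.sum_range_succ, Finset.sum_range_zero, zero_add,
    Matrix.add_mulVec, Matrix.smul_mulVec, ← Matrix.mulVec_mulVec, Matrix.one_mulVec,
    A_mulVec_hatv x y, diagonal_mulVec, minus_eq, zero_eq, plus_eq, hat_eq,
    Matrix.mulVec_add, Matrix.mulVec_smul, trivial_block] at eigen_expansion unit_expansion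
  ext u
  have e₁ := congrFun eigen_expansion u
  have e₂ := congrFun unit_expansion u
  have e₃ := congrFun neighbours u
  simp only [norton, Pi.add_apply, Pi.smul_apply, smul_eq_mul] at e₁ e₂ e₃ ⊢
  rw [mul_comm (E 1 *ᵥ Γ.hatv x)]
  rw [eq_inv_mul_iff_mul_eq₀ (mul_ne_zero hn hθ)]
  field_simp at e₁ e₂
  linear_combination -e₁ + θ 2 * e₂ - ts i * e₃
end

section
/- Assume Γ is Q-polynomial with respect to E. Then for all vertices x, y ∈ X: E(A x̂ ∘ E ŷ) − θ₂ E(x̂ ∘ E ŷ) = (θ₀ − θ₂) |X|^{-1} E ŷ + (θ₁ − θ₂) (E x̂ ⋆ E ŷ). -/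
open Matrix Finset
open scoped Classical

namespace Matrix

variable {m : Type*} [Fintype m]

/-- The squared entries of `E (F x̂ ∘ G ŷ)`, summed over all positions, for symmetric idempotents
`E`, `F`, `G`. -/
theorem sum_sq_triple_product {E F G : Matrix m m ℝ}
    (hE : E.IsSymm) (hF : F.IsSymm) (hG : G.IsSymm)
    (hE2 : E * E = E) (hF2 : F * F = F) (hG2 : G * G = G) :
    ∑ x, ∑ y, ∑ w, (∑ z, E w z * (F z x * G z y)) ^ 2 =
      ∑ z, ∑ z', E z z' * F z z' * G z z' := by
  have key : ∀ {M : Matrix m m ℝ}, M.IsSymm → M * M = M →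
      ∀ z z', ∑ w, M z w * M z' w = M z z' := by
    intro M hM hM2 z z'
    conv_rhs => rw [← hM2, Matrix.mul_apply]
    exact Finset.sum_congr rfl fun w _ => by rw [hM.apply z' w]
  have step : ∀ v : m → ℝ,
      ∑ w, (∑ z, E w z * v z) ^ 2 = ∑ z, ∑ z', E z z' * (v z * v z') := by
    intro v
    simp_rw [sq, Finset.sum_mul_sum]
    rw [Finset.sum_comm]
    refine Finset.sum_congr rfl fun z _ => ?_
    rw [Finset.sum_comm]
    refine Finset.sum_congr rfl fun z' _ => ?_
    rw [← key hE hE2 z z', Finset.sum_mul]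
    refine Finset.sum_congr rfl fun w _ => ?_
    rw [hE.apply z w, hE.apply z' w]
    ring
  simp_rw [step]
  have swap : ∀ f : m → m → m → m → ℝ,
      ∑ x, ∑ y, ∑ z, ∑ z', f x y z z' = ∑ z, ∑ z', ∑ x, ∑ y, f x y z z' := by
    intro f
    rw [Finset.sum_congr rfl fun x _ => Finset.sum_comm, Finset.sum_comm]
    refine Finset.sum_congr rfl fun z _ => ?_
    rw [Finset.sum_congr rfl fun x _ => Finset.sum_comm, Finset.sum_comm]
  rw [swap]
  refine Finset.sum_congr rfl fun z _ => Finset.sum_congr rfl fun z' _ => ?_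
  conv_rhs => rw [← key hF hF2 z z', ← key hG hG2 z z', mul_assoc, Finset.sum_mul_sum,
    Finset.mul_sum]
  refine Finset.sum_congr rfl fun x _ => ?_
  rw [Finset.mul_sum]
  exact Finset.sum_congr rfl fun y _ => by ring

end Matrix

namespace DRG

variable {Γ : DRG} {E : ℕ → Matrix Γ.X Γ.X ℝ} {θ : ℕ → ℝ}

theorem A_isSymm (Γ : DRG) : Γ.A.IsSymm := by
  ext x y
  simp [A, Ai, SimpleGraph.adj_comm]

theorem IsPrimIdemSeq.A_mul (hE : Γ.IsPrimIdemSeq E θ) {j : ℕ} (hj : j ≤ Γ.d) :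
    Γ.A * E j = θ j • E j := by
  obtain ⟨-, -, h2, hA, -⟩ := hE
  rw [hA, Finset.sum_mul, Finset.sum_eq_single j]
  · rw [smul_mul_assoc, h2 j j hj hj, if_pos rfl]
  · intro i hi hij
    rw [smul_mul_assoc, h2 i j (Nat.lt_succ_iff.1 (Finset.mem_range.1 hi)) hj, if_neg hij,
      smul_zero]
  · intro h
    exact absurd (Finset.mem_range.2 (Nat.lt_succ_of_le hj)) h

theorem IsPrimIdemSeq.isSymm (hE : Γ.IsPrimIdemSeq E θ) {i : ℕ} (hi : i ≤ Γ.d) :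
    (E i).IsSymm := by
  have horth : ∀ j ≤ Γ.d, j ≠ i → (E i)ᵀ * E j = 0 := by
    intro j hj hji
    have h1 : θ i • ((E i)ᵀ * E j) = θ j • ((E i)ᵀ * E j) := by
      rw [← mul_smul_comm (θ j), ← hE.A_mul hj, ← mul_assoc, ← smul_mul_assoc,
        ← Matrix.transpose_smul, ← hE.A_mul hi, Matrix.transpose_mul, Γ.A_isSymm.eq]
    have h2 : (θ i - θ j) • ((E i)ᵀ * E j) = 0 := by rw [sub_smul, h1, sub_self]
    refine (smul_eq_zero.1 h2).resolve_left fun h => hji ?_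
    exact (hE.2.2.2.2 i j hi hj (sub_eq_zero.1 h)).symm
  have h : (E i)ᵀ = (E i)ᵀ * E i := by
    conv_lhs => rw [← mul_one (E i)ᵀ, ← hE.2.1, Finset.mul_sum]
    refine Finset.sum_eq_single i
      (fun j hj => horth j (Nat.lt_succ_iff.1 (Finset.mem_range.1 hj))) fun h => ?_
    exact absurd (Finset.mem_range.2 (Nat.lt_succ_of_le hi)) h
  have h' := congrArg Matrix.transpose h
  rw [Matrix.transpose_mul, Matrix.transpose_transpose, ← h] at h'
  exact h'.symm

/-- A vanishing Krein parameter `q h i j` makes the triple product of the corresponding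
eigenspaces vanish. -/
theorem IsPrimIdemSeq.mulVec_mul_eq_zero (hE : Γ.IsPrimIdemSeq E θ) {q : ℕ → ℕ → ℕ → ℝ}
    (hq : Γ.IsKrein E q) {h i j : ℕ} (hh : h ≤ Γ.d) (hi : i ≤ Γ.d) (hj : j ≤ Γ.d)
    (h0 : q h i j = 0) (x y : Γ.X) :
    E h *ᵥ ((E i *ᵥ Γ.hatv x) * (E j *ᵥ Γ.hatv y)) = 0 := by
  have idem : ∀ l ≤ Γ.d, E l * E l = E l := fun l hl => by
    rw [hE.2.2.1 l l hl hl, if_pos rfl]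
  have hmul : Matrix.hadamard (E i) (E j) * E h = 0 := by
    rw [hq i j hi hj, smul_mul_assoc, Finset.sum_mul, Finset.sum_eq_zero, smul_zero]
    intro l hl
    rw [smul_mul_assoc, hE.2.2.1 l h (Nat.lt_succ_iff.1 (Finset.mem_range.1 hl)) hh]
    split_ifs with hlh
    · rw [hlh, h0, zero_smul]
    · rw [smul_zero]
  have hsum := Matrix.sum_sq_triple_product (hE.isSymm hh) (hE.isSymm hi) (hE.isSymm hj)
    (idem h hh) (idem i hi) (idem j hj)
  have hzero : ∑ z, ∑ z', E h z z' * E i z z' * E j z z' = 0 := by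
    refine Finset.sum_eq_zero fun z _ => ?_
    have := congrFun (congrFun hmul z) z
    rw [Matrix.mul_apply, Matrix.zero_apply] at this
    rw [← this]
    refine Finset.sum_congr rfl fun z' _ => ?_
    rw [Matrix.hadamard_apply, (hE.isSymm hh).apply z z']
    ring
  rw [hzero, Finset.sum_eq_zero_iff_of_nonneg fun _ _ => by positivity] at hsum
  have hx := hsum x (Finset.mem_univ x)
  rw [Finset.sum_eq_zero_iff_of_nonneg fun _ _ => by positivity] at hx
  have hy := hx y (Finset.mem_univ y)
  rw [Finset.sum_eq_zero_iff_of_nonneg fun _ _ => by positivity] at hy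
  ext w
  have hw := pow_eq_zero_iff two_ne_zero |>.1 (hy w (Finset.mem_univ w))
  simpa [Matrix.mulVec, dotProduct, hatv, Pi.single_apply] using hw

end DRG

/-- first evaluation of `E(A x̂ ∘ E ŷ) − θ₂ E(x̂ ∘ E ŷ)`. -/
theorem DRG.first_evaluation (Γ : DRG) (E : ℕ → Matrix Γ.X Γ.X ℝ) (θ : ℕ → ℝ)
    (hE : Γ.IsPrimIdemSeq E θ)
    (q : ℕ → ℕ → ℕ → ℝ) (hq : Γ.IsKrein E q) (hQ : Γ.IsQPolynomial q) (x y : Γ.X) :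
    E 1 *ᵥ ((Γ.A *ᵥ Γ.hatv x) * (E 1 *ᵥ Γ.hatv y)) -
        θ 2 • (E 1 *ᵥ (Γ.hatv x * (E 1 *ᵥ Γ.hatv y))) =
      ((θ 0 - θ 2) * (Γ.n)⁻¹) • (E 1 *ᵥ Γ.hatv y) +
        (θ 1 - θ 2) • Γ.norton (E 1) (E 1 *ᵥ Γ.hatv x) (E 1 *ᵥ Γ.hatv y) := by
  have hd := Γ.d_ge_two
  have hA : Γ.A *ᵥ Γ.hatv x = ∑ i ∈ Finset.range (Γ.d + 1), θ i • (E i *ᵥ Γ.hatv x) := by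
    rw [hE.2.2.2.1, Matrix.sum_mulVec]
    exact Finset.sum_congr rfl fun i _ => Matrix.smul_mulVec _ _ _
  have hI : Γ.hatv x = ∑ i ∈ Finset.range (Γ.d + 1), E i *ᵥ Γ.hatv x := by
    rw [← Matrix.sum_mulVec, hE.2.1, Matrix.one_mulVec]
  have hdiff : Γ.A *ᵥ Γ.hatv x - θ 2 • Γ.hatv x =
      ∑ i ∈ Finset.range (Γ.d + 1), (θ i - θ 2) • (E i *ᵥ Γ.hatv x) := by
    conv_lhs => rw [hA, hI]
    rw [Finset.smul_sum, ← Finset.sum_sub_distrib]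
    simp [sub_smul, ← hI]
  have h0 : E 1 *ᵥ ((E 0 *ᵥ Γ.hatv x) * (E 1 *ᵥ Γ.hatv y)) =
      (Γ.n)⁻¹ • (E 1 *ᵥ Γ.hatv y) := by
    have hconst : (E 0 *ᵥ Γ.hatv x) * (E 1 *ᵥ Γ.hatv y) = (Γ.n)⁻¹ • (E 1 *ᵥ Γ.hatv y) := by
      ext z
      simp [hE.1, hatv, Jmat]
    rw [hconst, Matrix.mulVec_smul, Matrix.mulVec_mulVec,
      hE.2.2.1 1 1 (by omega) (by omega), if_pos rfl]
  rw [← Matrix.mulVec_smul, ← Matrix.mulVec_sub, ← smul_mul_assoc, ← sub_mul, hdiff,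
    Finset.sum_mul, Matrix.mulVec_sum, ← Finset.sum_subset (s₁ := Finset.range 2)]
  · simp only [Finset.sum_range_succ, Finset.sum_range_zero, zero_add, smul_mul_assoc,
      Matrix.mulVec_smul, h0, smul_smul, norton]
  · exact Finset.range_subset_range.2 (by omega)
  · intro i hi hi2
    rw [Finset.mem_range] at hi hi2
    rw [smul_mul_assoc, Matrix.mulVec_smul]
    obtain rfl | hi3 : i = 2 ∨ 2 < i := by omega
    · rw [sub_self, zero_smul]
    · rw [hE.mulVec_mul_eq_zero hq (by omega) (by omega) (by omega)
        ((hQ 1 i 1 (by omega) (by omega) (by omega)).1 (by omega)), smul_zero]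
end

section
/- For all vertices x, y ∈ X with i = ∂(x,y): E(A x̂ ∘ E ŷ) − θ₂ E(x̂ ∘ E ŷ) = |X|^{-1} ( θ*_{i-1} E x⁻_y + θ*_i E x⁰_y + θ*_{i+1} E x⁺_y − θ₂ θ*_i E x̂ ). -/
open Matrix Finset
open scoped Classical

namespace DRG

variable (Γ : DRG)

/-- Column `y` of `E` records the dual eigenvalue at each distance from `y`. -/
lemma IsDualEigs.mulVec_hatv_apply {Γ : DRG} {E : Matrix Γ.X Γ.X ℝ} {ts : ℤ → ℝ}
    (hts : Γ.IsDualEigs E ts) (y z : Γ.X) :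
    (E *ᵥ Γ.hatv y) z = (Γ.n)⁻¹ * ts (Γ.G.dist z y) := by
  have hlt : Γ.G.dist z y < Γ.d + 1 := Nat.lt_succ_of_le (Γ.dist_le z y)
  rw [hts, hatv, Matrix.mulVec_single_one]
  simp [Matrix.smul_apply, Matrix.sum_apply, Ai, hlt]

lemma A_mulVec_hatv_apply (x z : Γ.X) :
    (Γ.A *ᵥ Γ.hatv x) z = if Γ.G.dist x z = 1 then 1 else 0 := by
  rw [hatv, Matrix.mulVec_single_one]
  simp [A, Ai, SimpleGraph.adj_comm]

/-- A sum of basis vectors over an intersection of spheres is its indicator function. -/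
lemma sum_hatv_sphere_inter_apply (x y z : Γ.X) (i j : ℕ) :
    (∑ w ∈ Γ.sphere x i ∩ Γ.sphere y j, Γ.hatv w) z =
      if Γ.G.dist x z = i ∧ Γ.G.dist y z = j then 1 else 0 := by
  simp [hatv, sphere, Finset.sum_apply, Pi.single_apply]

lemma A_mulVec_hatv_mul_mulVec_hatv {E : Matrix Γ.X Γ.X ℝ} {ts : ℤ → ℝ}
    (hts : Γ.IsDualEigs E ts) (x y : Γ.X) :
    (Γ.A *ᵥ Γ.hatv x) * (E *ᵥ Γ.hatv y) =
      (Γ.n)⁻¹ • (ts ((Γ.G.dist x y : ℤ) - 1) • Γ.minusv x y +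
        ts (Γ.G.dist x y) • Γ.zerov x y + ts ((Γ.G.dist x y : ℤ) + 1) • Γ.plusv x y) := by
  ext z
  simp only [Pi.mul_apply, Pi.smul_apply, Pi.add_apply, smul_eq_mul, A_mulVec_hatv_apply,
    hts.mulVec_hatv_apply, minusv, zerov, plusv, sum_hatv_sphere_inter_apply]
  by_cases hxz : Γ.G.dist x z = 1
  · have h₁ := Γ.conn.dist_triangle (u := x) (v := z) (w := y)
    have h₂ := Γ.conn.dist_triangle (u := z) (v := x) (w := y)
    rw [SimpleGraph.dist_comm (u := z) (v := x)] at h₂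
    rw [SimpleGraph.dist_comm (u := y) (v := z)]
    have hpos : Γ.G.dist x y = 0 → Γ.G.dist z y = 1 := by
      intro h
      rw [Γ.conn.dist_eq_zero_iff] at h
      rw [← h, SimpleGraph.dist_comm, hxz]
    generalize Γ.G.dist x y = i at *
    generalize Γ.G.dist z y = j at *
    obtain h | h | h : j = i + 1 ∨ j = i ∨ i = j + 1 := by omega
    · subst h
      have h' : ¬ i + 1 = i - 1 := by omega
      simp [hxz, h']
    · subst h
      have h' : ¬ j = j - 1 := by omega
      simp [hxz, h']
    · subst h
      have h' : ¬ j = j + 1 + 1 := by omega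
      simp [hxz, h']
  · simp [hxz]

lemma hatv_mul_mulVec_hatv {E : Matrix Γ.X Γ.X ℝ} {ts : ℤ → ℝ}
    (hts : Γ.IsDualEigs E ts) (x y : Γ.X) :
    Γ.hatv x * (E *ᵥ Γ.hatv y) = ((Γ.n)⁻¹ * ts (Γ.G.dist x y)) • Γ.hatv x := by
  ext z
  rw [Pi.mul_apply, hts.mulVec_hatv_apply]
  by_cases h : z = x
  · subst h
    simp [mul_comm]
  · simp [hatv, h]

end DRG

/-- second evaluation of `E(A x̂ ∘ E ŷ) − θ₂ E(x̂ ∘ E ŷ)`. -/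
theorem DRG.second_evaluation (Γ : DRG) (E : ℕ → Matrix Γ.X Γ.X ℝ) (θ : ℕ → ℝ)
    (hE : Γ.IsPrimIdemSeq E θ)
    (ts : ℤ → ℝ) (hts : Γ.IsDualEigs (E 1) ts) (x y : Γ.X) :
    E 1 *ᵥ ((Γ.A *ᵥ Γ.hatv x) * (E 1 *ᵥ Γ.hatv y)) -
        θ 2 • (E 1 *ᵥ (Γ.hatv x * (E 1 *ᵥ Γ.hatv y))) =
      (Γ.n)⁻¹ •
        (ts ((Γ.G.dist x y : ℤ) - 1) • (E 1 *ᵥ Γ.minusv x y) +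
          ts (Γ.G.dist x y) • (E 1 *ᵥ Γ.zerov x y) +
          ts ((Γ.G.dist x y : ℤ) + 1) • (E 1 *ᵥ Γ.plusv x y) -
          (θ 2 * ts (Γ.G.dist x y)) • (E 1 *ᵥ Γ.hatv x)) := by
  rw [Γ.A_mulVec_hatv_mul_mulVec_hatv hts, Γ.hatv_mul_mulVec_hatv hts]
  simp only [Matrix.mulVec_smul, Matrix.mulVec_add]
  module
end
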